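/- Let N, M be positive integers and κ > 1, and let α be a real number with 0 < α ≤ (N+M)²/((2+√5)κ²). Then the maximum over λ in the interval [(N+M)/κ, N+M] of |g(λ)|, where g(λ) = (α − λ²)/(λ(λ² + α)), equals ((N+M)²κ − κ³α) / ((N+M)((N+M)² + κ²α)), and this maximum is attained at λ = (N+M)/κ. -/

import Mathlib

/-- If `(2 + √5) α ≤ a ^ 2`, then `x ↦ (x ^ 2 - α) / (x (x ^ 2 + α))` is maximal on `[a, ∞)`
at `a`. -/
theorem sq_sub_div_mul_sq_add_le {a x α : ℝ} (ha : 0 < a) (hax : a ≤ x) (hα : 0 < α)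
    (h : (2 + Real.sqrt 5) * α ≤ a ^ 2) :
    (x ^ 2 - α) / (x * (x ^ 2 + α)) ≤ (a ^ 2 - α) / (a * (a ^ 2 + α)) := by
  have hx : 0 < x := ha.trans_le hax
  have h5 : Real.sqrt 5 ^ 2 = 5 := Real.sq_sqrt (by norm_num)
  have h2 : 2 ≤ Real.sqrt 5 := Real.le_sqrt_of_sq_le (by norm_num)
  have h4 : 4 * α ≤ a ^ 2 := by nlinarith
  have hquartic : 0 ≤ a ^ 4 - 4 * α * a ^ 2 - α ^ 2 := by
    have : 0 ≤ (a ^ 2 - (2 + Real.sqrt 5) * α) * (a ^ 2 + (Real.sqrt 5 - 2) * α) :=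
      mul_nonneg (by linarith) (by nlinarith [mul_nonneg (sub_nonneg.2 h2) hα.le])
    linear_combination this - α ^ 2 * h5
  have hcross : 0 ≤ a ^ 2 * (x + a) - α * (x + 3 * a) := by
    have : 0 ≤ (a ^ 2 - 4 * α) * (x + a) := mul_nonneg (by linarith) (by linarith)
    nlinarith [mul_pos hα hx, mul_pos hα ha]
  have hfactor : 0 ≤ a ^ 2 * x ^ 2 - α ^ 2 - α * (x + a) ^ 2 := by
    linear_combination hquartic + mul_nonneg (sub_nonneg.2 hax) hcross
  rw [div_le_div_iff₀ (by positivity) (by positivity)]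
  linear_combination mul_nonneg (sub_nonneg.2 hax) hfactor


/-- For `0 < α ≤ (N+M)²/((2+√5)κ²)` with `κ > 1`, the maximum of
`|g(λ)| = |(α − λ²)/(λ(λ² + α))|` over `λ ∈ [(N+M)/κ, N+M]` equals
`((N+M)²κ − κ³α)/((N+M)((N+M)² + κ²α))`, attained at `λ = (N+M)/κ`. -/
theorem max_abs_g (N M : ℕ) (hN : 0 < N) (hM : 0 < M) (κ α : ℝ) (hκ : 1 < κ)
    (hα : 0 < α) (hα2 : α ≤ ((N : ℝ) + M) ^ 2 / ((2 + Real.sqrt 5) * κ ^ 2)) :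
    IsGreatest
      ((fun lam : ℝ => |(α - lam ^ 2) / (lam * (lam ^ 2 + α))|) ''
        Set.Icc (((N : ℝ) + M) / κ) ((N : ℝ) + M))
      ((((N : ℝ) + M) ^ 2 * κ - κ ^ 3 * α) /
        (((N : ℝ) + M) * (((N : ℝ) + M) ^ 2 + κ ^ 2 * α))) ∧
    |(α - (((N : ℝ) + M) / κ) ^ 2) /
        ((((N : ℝ) + M) / κ) * ((((N : ℝ) + M) / κ) ^ 2 + α))| =
      (((N : ℝ) + M) ^ 2 * κ - κ ^ 3 * α) /
        (((N : ℝ) + M) * (((N : ℝ) + M) ^ 2 + κ ^ 2 * α)) := by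
  have hL : (0 : ℝ) < (N : ℝ) + M := by positivity
  generalize (N : ℝ) + M = L at *
  have hκ0 : 0 < κ := by linarith
  have ha : 0 < L / κ := by positivity
  have hbound : (2 + Real.sqrt 5) * α ≤ (L / κ) ^ 2 := by
    rw [le_div_iff₀ (by positivity)] at hα2
    rw [div_pow, le_div_iff₀ (by positivity)]
    linarith
  have habs {x : ℝ} (hx : L / κ ≤ x) :
      |(α - x ^ 2) / (x * (x ^ 2 + α))| = (x ^ 2 - α) / (x * (x ^ 2 + α)) := by
    have hx0 : 0 < x := ha.trans_le hx
    have hsq : (L / κ) ^ 2 ≤ x ^ 2 := by gcongr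
    have hαx : α ≤ x ^ 2 := by nlinarith [Real.sqrt_nonneg 5]
    rw [abs_div, abs_of_nonpos (by linarith), abs_of_pos (by positivity), neg_sub]
  have hval : |(α - (L / κ) ^ 2) / ((L / κ) * ((L / κ) ^ 2 + α))| =
      (L ^ 2 * κ - κ ^ 3 * α) / (L * (L ^ 2 + κ ^ 2 * α)) := by
    rw [habs le_rfl]
    field_simp
  refine ⟨⟨⟨L / κ, ⟨le_rfl, div_le_self hL.le hκ.le⟩, hval⟩, ?_⟩, hval⟩
  rintro _ ⟨x, hx, rfl⟩
  rw [← hval, habs le_rfl]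
  exact (habs hx.1).trans_le (sq_sub_div_mul_sq_add_le ha hx.1 hα hbound)
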